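/- Let (Ω, 𝔉, ℙ) be a probability space and let g₀, gₙ : Ω → ℂ^M be random vectors all of whose pairwise component products are integrable. Let R be an M×M Hermitian positive definite matrix, D an M×M Hermitian matrix, and c ∈ ℝ, and assume the second-moment structure E[gₙ gₙᴴ] = R, E[g₀ g₀ᴴ] = R, and E[g₀ gₙᴴ] = c·R·D. For A ∈ M_M(ℂ) define the mean-square error MSE(A) = E[‖gₙ − A g₀‖²] (squared Euclidean norm on ℂ^M). Then MSE(A) = tr(R) − c²·tr(D R D) + Re(tr((A − cD) R (A − cD)ᴴ)) for every A; hence MSE is uniquely minimized over M_M(ℂ) at A = cD, with minimum value tr(R) − c²·tr(D R D). -/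

import Mathlib

open Matrix MeasureTheory ComplexOrder

/-- The mean-square error of the linear estimator `A x` of `y`, in terms of second moments. -/
theorem integral_sum_norm_sub_mulVec_sq {m n Ω : Type*} [Fintype m] [Fintype n]
    [MeasurableSpace Ω] {μ : Measure Ω} {x : Ω → n → ℂ} {y : Ω → m → ℂ}
    (hxx : ∀ i j, Integrable (fun ω => x ω i * (starRingEnd ℂ) (x ω j)) μ)
    (hyy : ∀ i j, Integrable (fun ω => y ω i * (starRingEnd ℂ) (y ω j)) μ)
    (hxy : ∀ i j, Integrable (fun ω => x ω i * (starRingEnd ℂ) (y ω j)) μ)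
    {R : Matrix n n ℂ} {S : Matrix m m ℂ} {C : Matrix n m ℂ}
    (hR : ∀ i j, ∫ ω, x ω i * (starRingEnd ℂ) (x ω j) ∂μ = R i j)
    (hS : ∀ i j, ∫ ω, y ω i * (starRingEnd ℂ) (y ω j) ∂μ = S i j)
    (hC : ∀ i j, ∫ ω, x ω i * (starRingEnd ℂ) (y ω j) ∂μ = C i j)
    (A : Matrix m n ℂ) :
    ∫ ω, ∑ i, ‖y ω i - (A *ᵥ x ω) i‖ ^ 2 ∂μ
      = S.trace.re - 2 * (A * C).trace.re + (A * R * Aᴴ).trace.re := by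
  have pointwise (a b : ℂ) :
      ‖a - b‖ ^ 2 = (a * (starRingEnd ℂ) a - 2 * (b * (starRingEnd ℂ) a)
        + b * (starRingEnd ℂ) b).re := by
    rw [← Complex.normSq_eq_norm_sq, Complex.normSq_apply]
    simp only [Complex.sub_re, Complex.sub_im, Complex.add_re, Complex.mul_re, Complex.mul_im,
      Complex.conj_re, Complex.conj_im, Complex.re_ofNat, Complex.im_ofNat]
    ring
  have expand (ω : Ω) : ∑ i, ‖y ω i - (A *ᵥ x ω) i‖ ^ 2
      = RCLike.re (∑ i, (y ω i * (starRingEnd ℂ) (y ω i)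
        - 2 * ∑ j, A i j * (x ω j * (starRingEnd ℂ) (y ω i))
        + ∑ k, ∑ j, A i j * (x ω j * (starRingEnd ℂ) (x ω k)) * (starRingEnd ℂ) (A i k))) := by
    rw [RCLike.re_eq_complex_re, Complex.re_sum]
    refine Finset.sum_congr rfl fun i _ => ?_
    rw [pointwise]
    simp only [mulVec, dotProduct, map_sum, map_mul, Finset.sum_mul, Finset.mul_sum, mul_assoc]
    congr! 6
    ring
  have int_xy (i : m) (j : n) :
      Integrable (fun ω => A i j * (x ω j * (starRingEnd ℂ) (y ω i))) μ := (hxy j i).const_mul _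
  have int_xx (i : m) (k j : n) : Integrable
      (fun ω => A i j * (x ω j * (starRingEnd ℂ) (x ω k)) * (starRingEnd ℂ) (A i k)) μ :=
    ((hxx j k).const_mul _).mul_const _
  have int_sum_xy (i : m) :
      Integrable (fun ω => 2 * ∑ j, A i j * (x ω j * (starRingEnd ℂ) (y ω i))) μ :=
    (integrable_finsetSum _ fun j _ => int_xy i j).const_mul _
  have int_sum_xx (i : m) (k : n) : Integrable
      (fun ω => ∑ j, A i j * (x ω j * (starRingEnd ℂ) (x ω k)) * (starRingEnd ℂ) (A i k)) μ :=
    integrable_finsetSum _ fun j _ => int_xx i k j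
  have int_sub (i : m) : Integrable (fun ω => y ω i * (starRingEnd ℂ) (y ω i)
      - 2 * ∑ j, A i j * (x ω j * (starRingEnd ℂ) (y ω i))) μ := (hyy i i).sub (int_sum_xy i)
  have int_quad (i : m) : Integrable (fun ω => ∑ k, ∑ j,
      A i j * (x ω j * (starRingEnd ℂ) (x ω k)) * (starRingEnd ℂ) (A i k)) μ :=
    integrable_finsetSum _ fun k _ => int_sum_xx i k
  have int_summand (i : m) : Integrable (fun ω => y ω i * (starRingEnd ℂ) (y ω i)
      - 2 * ∑ j, A i j * (x ω j * (starRingEnd ℂ) (y ω i))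
      + ∑ k, ∑ j, A i j * (x ω j * (starRingEnd ℂ) (x ω k)) * (starRingEnd ℂ) (A i k)) μ :=
    (int_sub i).add (int_quad i)
  simp_rw [expand]
  rw [integral_re (integrable_finsetSum _ fun i _ => int_summand i),
    integral_finsetSum _ fun i _ => int_summand i]
  have moment (i : m) : ∫ ω, (y ω i * (starRingEnd ℂ) (y ω i)
      - 2 * ∑ j, A i j * (x ω j * (starRingEnd ℂ) (y ω i))
      + ∑ k, ∑ j, A i j * (x ω j * (starRingEnd ℂ) (x ω k)) * (starRingEnd ℂ) (A i k)) ∂μ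
      = S i i - 2 * (A * C) i i + (A * R * Aᴴ) i i := by
    rw [integral_add (int_sub i) (int_quad i), integral_sub (hyy i i) (int_sum_xy i),
      integral_const_mul, integral_finsetSum _ fun j _ => int_xy i j,
      integral_finsetSum _ fun k _ => int_sum_xx i k, hS]
    simp_rw [integral_finsetSum _ fun j _ => int_xx i _ j, integral_mul_const,
      integral_const_mul, hR, hC, mul_apply, Finset.sum_mul, conjTranspose_apply,
      starRingEnd_apply]
  simp_rw [moment, Finset.sum_add_distrib, Finset.sum_sub_distrib, ← Finset.mul_sum]
  simp [trace]

/-- Completing the square in the trace form of a Hermitian matrix. -/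
theorem re_trace_sub_smul_mul_mul_conjTranspose {n : Type*} [Fintype n]
    {R D : Matrix n n ℂ} (hR : R.IsHermitian) (hD : D.IsHermitian) (c : ℝ) (A : Matrix n n ℂ) :
    ((A - (c : ℂ) • D) * R * (A - (c : ℂ) • D)ᴴ).trace.re
      = (A * R * Aᴴ).trace.re - 2 * (A * ((c : ℂ) • (R * D))).trace.re
        + c ^ 2 * (D * R * D).trace.re := by
  have hconj : (D * R * Aᴴ).trace.re = (A * R * D).trace.re := by
    rw [← Complex.conj_re, starRingEnd_apply, ← trace_conjTranspose]
    simp [conjTranspose_mul, hR.eq, hD.eq, Matrix.mul_assoc]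
  simp only [conjTranspose_sub, conjTranspose_smul, hD.eq, Matrix.sub_mul, Matrix.mul_sub,
    Matrix.smul_mul, Matrix.mul_smul, trace_sub, trace_smul, ← Matrix.mul_assoc,
    Complex.star_def, Complex.conj_ofReal, smul_eq_mul, Complex.sub_re, Complex.re_ofReal_mul,
    hconj]
  ring

theorem Matrix.PosDef.trace_mul_mul_conjTranspose_eq_zero_iff {m n : Type*} [Fintype m]
    [Fintype n] {R : Matrix n n ℂ} (hR : R.PosDef) (B : Matrix m n ℂ) :
    (B * R * Bᴴ).trace = 0 ↔ B = 0 := by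
  classical
  refine ⟨fun h => ?_, fun h => by simp [h]⟩
  rw [(hR.posSemidef.mul_mul_conjTranspose_same B).trace_eq_zero_iff] at h
  ext i j
  by_contra hij
  have hne : star (B i) ≠ 0 := fun h0 => hij (by simpa using congrFun h0 j)
  have hpos := hR.dotProduct_mulVec_pos hne
  have hii : (B * R * Bᴴ) i i = 0 := by rw [h]; rfl
  refine hpos.ne' ?_
  rw [← hii, Matrix.mul_assoc, star_star]
  rfl

/-- if `E[gₙ gₙᴴ] = E[g₀ g₀ᴴ] = R` and `E[g₀ gₙᴴ] = c·R·D` with `R` Hermitian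
positive definite and `D` Hermitian, then the mean-square error
`MSE(A) = E[‖gₙ − A g₀‖²]` equals
`tr(R) − c²·tr(D R D) + Re(tr((A − cD) R (A − cD)ᴴ))` for every `A`, and is uniquely
minimized over `M_M(ℂ)` at `A = cD`, with minimum value `tr(R) − c²·tr(D R D)`. -/
theorem stmt_1 {M : ℕ} {Ω : Type*} [MeasurableSpace Ω] (ℙ : Measure Ω) [IsProbabilityMeasure ℙ]
    (g₀ gₙ : Ω → Fin M → ℂ)
    (hInt00 : ∀ i j, Integrable (fun ω => g₀ ω i * (starRingEnd ℂ) (g₀ ω j)) ℙ)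
    (hIntnn : ∀ i j, Integrable (fun ω => gₙ ω i * (starRingEnd ℂ) (gₙ ω j)) ℙ)
    (hInt0n : ∀ i j, Integrable (fun ω => g₀ ω i * (starRingEnd ℂ) (gₙ ω j)) ℙ)
    (hIntn0 : ∀ i j, Integrable (fun ω => gₙ ω i * (starRingEnd ℂ) (g₀ ω j)) ℙ)
    (R D : Matrix (Fin M) (Fin M) ℂ)
    (hR : R.IsHermitian) (hRpd : R.PosDef) (hD : D.IsHermitian) (c : ℝ)
    (hmomn : ∀ i j, ∫ ω, gₙ ω i * (starRingEnd ℂ) (gₙ ω j) ∂ℙ = R i j)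
    (hmom0 : ∀ i j, ∫ ω, g₀ ω i * (starRingEnd ℂ) (g₀ ω j) ∂ℙ = R i j)
    (hmom0n : ∀ i j, ∫ ω, g₀ ω i * (starRingEnd ℂ) (gₙ ω j) ∂ℙ = ((c : ℂ) • (R * D)) i j)
    (MSE : Matrix (Fin M) (Fin M) ℂ → ℝ)
    (hMSE : ∀ A, MSE A = ∫ ω, ∑ i, ‖gₙ ω i - A.mulVec (g₀ ω) i‖ ^ 2 ∂ℙ) :
    (∀ A : Matrix (Fin M) (Fin M) ℂ,
        MSE A = (R.trace).re - c ^ 2 * ((D * R * D).trace).re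
          + (((A - (c : ℂ) • D) * R * (A - (c : ℂ) • D)ᴴ).trace).re)
    ∧ (∀ A : Matrix (Fin M) (Fin M) ℂ, MSE ((c : ℂ) • D) ≤ MSE A)
    ∧ (∀ A : Matrix (Fin M) (Fin M) ℂ, MSE A = MSE ((c : ℂ) • D) ↔ A = (c : ℂ) • D)
    ∧ MSE ((c : ℂ) • D) = (R.trace).re - c ^ 2 * ((D * R * D).trace).re := by
  have mse_eq (A : Matrix (Fin M) (Fin M) ℂ) :
      MSE A = (R.trace).re - c ^ 2 * ((D * R * D).trace).re
        + (((A - (c : ℂ) • D) * R * (A - (c : ℂ) • D)ᴴ).trace).re := by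
    rw [hMSE, integral_sum_norm_sub_mulVec_sq hInt00 hIntnn hInt0n hmom0 hmomn hmom0n,
      re_trace_sub_smul_mul_mul_conjTranspose hR hD]
    ring
  have mse_min : MSE ((c : ℂ) • D) = (R.trace).re - c ^ 2 * ((D * R * D).trace).re := by
    simp [mse_eq]
  have excess_nonneg (A : Matrix (Fin M) (Fin M) ℂ) :=
    (hRpd.posSemidef.mul_mul_conjTranspose_same (A - (c : ℂ) • D)).trace_nonneg
  refine ⟨mse_eq, fun A => ?_, fun A => ?_, mse_min⟩
  · rw [mse_min, mse_eq]
    exact le_add_of_nonneg_right (Complex.nonneg_iff.mp (excess_nonneg A)).1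
  · rw [mse_min, mse_eq, add_eq_left, ← sub_eq_zero (a := A),
      ← hRpd.trace_mul_mul_conjTranspose_eq_zero_iff, Complex.ext_iff]
    exact ⟨fun h => ⟨h, (Complex.nonneg_iff.mp (excess_nonneg A)).2.symm⟩, And.left⟩
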